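/- arXiv:1301.1076 — 2 statements merged into one kernel-verified Lean document; each statement's English description precedes it below -/
import Mathlib

section
/- Let α and β be irrational real numbers which are quadratic units, say α² = τα − ε and β² = τ'β − ε' with τ, τ' ∈ ℤ and ε, ε' ∈ {1, −1}, let J be a nonzero ideal of the subring ℤ[α] of ℝ and K a nonzero ideal of ℤ[β], and let G(α,J) = J ⋊_α ℤ and G(β,K) = K ⋊_β ℤ. Then G(α,J) and G(β,K) are isomorphic as groups if and only if either (β = α or β = α⁻¹, and there exist nonzero λ, μ ∈ ℤ[α] with λ·J = μ·K) or (β = ᾱ or β = ᾱ⁻¹, where ᾱ = τ − α, and there exist nonzero λ, μ ∈ ℤ[α] with λ·J̄ = μ·K, where J̄ is the image of J under the conjugation automorphism of ℤ[α] sending α to τ − α). -/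
/-- `G(a, J) = J ⋊_a ℤ`, realized concretely as the group of permutations of `ℝ`
generated by multiplication by `a` and the translations by elements of `J`.
When `a` is a quadratic unit and `J` a nonzero ideal of `ℤ[a]`, this subgroup
consists exactly of the affine maps `x ↦ aⁿx + j` (`n ∈ ℤ`, `j ∈ J`), and is
isomorphic to the semidirect product `J ⋊_A ℤ` where the generator of `ℤ` acts
on `J` by multiplication by `a`. -/
noncomputable def solGroup (a : ℝ) (ha : a ≠ 0) (J : Set ℝ) : Subgroup (Equiv.Perm ℝ) :=
  Subgroup.closure ({Equiv.mulLeft₀ a ha} ∪ (fun j : ℝ => Equiv.addLeft j) '' J)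

open scoped commutatorElement

/-- Standing assumptions on a multiplier and an additive subgroup of `ℝ`. -/
structure GoodPair (a : ℝ) (S : AddSubgroup ℝ) : Prop where
  ne0 : a ≠ 0
  pw : ∀ n : ℤ, a ^ n = 1 → n = 0
  mul : ∀ s ∈ S, a * s ∈ S
  inv : ∀ s ∈ S, a⁻¹ * s ∈ S
  nz : ∃ s ∈ S, s ≠ 0

lemma GoodPair.zpow {a : ℝ} {S : AddSubgroup ℝ} (h : GoodPair a S) (n : ℤ) :
    ∀ s ∈ S, a ^ n * s ∈ S := by
  induction n using Int.induction_on with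
  | zero => intro s hs; simpa using hs
  | succ i ih =>
    intro s hs
    have := ih _ (h.mul s hs)
    rwa [← mul_assoc, ← zpow_add_one₀ h.ne0] at this
  | pred i ih =>
    intro s hs
    have := ih _ (h.inv s hs)
    rwa [← mul_assoc, ← zpow_sub_one₀ h.ne0] at this

lemma mulLeft_zpow_apply {a : ℝ} (ha : a ≠ 0) (n : ℤ) :
    ∀ x, ((Equiv.mulLeft₀ a ha : Equiv.Perm ℝ) ^ n) x = a ^ n * x := by
  have h : (Equiv.mulLeft₀ a ha : Equiv.Perm ℝ) = MulAction.toPermHom ℝˣ ℝ (Units.mk0 a ha) := by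
    ext x; simp [Units.smul_def]
  intro x
  rw [h, ← map_zpow]
  simp [Units.smul_def]

lemma mem_sol {a : ℝ} (ha : a ≠ 0) {S : AddSubgroup ℝ} (h : GoodPair a S) (g : Equiv.Perm ℝ) :
    g ∈ solGroup a ha (S : Set ℝ) ↔ ∃ n : ℤ, ∃ j ∈ S, ∀ x, g x = a ^ n * x + j := by
  constructor
  · intro hg
    unfold solGroup at hg
    induction hg using Subgroup.closure_induction with
    | mem x hx =>
      rcases hx with hx | ⟨j, hj, rfl⟩
      · rw [Set.mem_singleton_iff] at hx
        subst hx
        exact ⟨1, 0, S.zero_mem, fun x => by simp⟩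
      · exact ⟨0, j, hj, fun x => by simp [add_comm]⟩
    | one => exact ⟨0, 0, S.zero_mem, fun x => by simp⟩
    | mul x y _ _ hx hy =>
      obtain ⟨n, j, hj, hx⟩ := hx
      obtain ⟨m, k, hk, hy⟩ := hy
      refine ⟨n + m, a ^ n * k + j, S.add_mem (h.zpow n k hk) hj, fun z => ?_⟩
      rw [Equiv.Perm.mul_apply, hy, hx, zpow_add₀ ha]
      ring
    | inv x _ hx =>
      obtain ⟨n, j, hj, hx⟩ := hx
      refine ⟨-n, - (a ^ (-n) * j), S.neg_mem (h.zpow (-n) j hj), fun z => ?_⟩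
      rw [Equiv.Perm.inv_eq_iff_eq, hx]
      have : a ^ n ≠ 0 := zpow_ne_zero _ ha
      rw [zpow_neg]
      field_simp
      ring
  · rintro ⟨n, j, hj, hg⟩
    have : g = Equiv.addLeft j * (Equiv.mulLeft₀ a ha : Equiv.Perm ℝ) ^ n := by
      ext x
      rw [Equiv.Perm.mul_apply, mulLeft_zpow_apply, hg]
      simp [add_comm]
    rw [this]
    have h1 : (Equiv.addLeft j : Equiv.Perm ℝ) ∈ solGroup a ha (S : Set ℝ) :=
      Subgroup.subset_closure (Or.inr ⟨j, hj, rfl⟩)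
    have h2 : (Equiv.mulLeft₀ a ha : Equiv.Perm ℝ) ∈ solGroup a ha (S : Set ℝ) :=
      Subgroup.subset_closure (Or.inl rfl)
    exact mul_mem h1 (zpow_mem h2 n)

/-- The translation by `s` as an element of the group. -/
noncomputable def trEl {a : ℝ} (ha : a ≠ 0) {S : AddSubgroup ℝ} (s : ℝ) (hs : s ∈ S) :
    solGroup a ha (S : Set ℝ) :=
  ⟨Equiv.addLeft s, Subgroup.subset_closure (Or.inr ⟨s, hs, rfl⟩)⟩

/-- The multiplication by `a` as an element of the group. -/
noncomputable def mulEl {a : ℝ} (ha : a ≠ 0) (S : AddSubgroup ℝ) :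
    solGroup a ha (S : Set ℝ) :=
  ⟨Equiv.mulLeft₀ a ha, Subgroup.subset_closure (Or.inl rfl)⟩

lemma sol_ext {a : ℝ} {ha : a ≠ 0} {S : AddSubgroup ℝ} {g h : solGroup a ha (S : Set ℝ)}
    (H : ∀ x, g.1 x = h.1 x) : g = h := Subtype.ext (Equiv.ext H)

@[simp] lemma trEl_apply {a : ℝ} (ha : a ≠ 0) {S : AddSubgroup ℝ} (s : ℝ) (hs : s ∈ S) (x : ℝ) :
    (trEl ha s hs).1 x = s + x := rfl

@[simp] lemma mulEl_apply {a : ℝ} (ha : a ≠ 0) (S : AddSubgroup ℝ) (x : ℝ) :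
    (mulEl ha S).1 x = a * x := rfl

/-- Translations are exactly the elements commuting with all commutators. -/
lemma tr_iff {a : ℝ} {ha : a ≠ 0} {S : AddSubgroup ℝ} (h : GoodPair a S)
    (g : solGroup a ha (S : Set ℝ)) :
    (∃ s, ∃ hs : s ∈ S, g = trEl ha s hs) ↔
      ∀ p q : solGroup a ha (S : Set ℝ), g * ⁅p, q⁆ = ⁅p, q⁆ * g := by
  constructor
  · rintro ⟨s, hs, rfl⟩ p q
    have key : ∃ t, ∀ x, (⁅p, q⁆ : solGroup a ha (S : Set ℝ)).1 x = t + x := by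
      obtain ⟨n, j, hj, hp⟩ := (mem_sol ha h p.1).1 p.2
      obtain ⟨m, k, hk, hq⟩ := (mem_sol ha h q.1).1 q.2
      obtain ⟨l, t, ht, hc⟩ := (mem_sol ha h (⁅p, q⁆ : solGroup a ha (S : Set ℝ)).1).1 (⁅p, q⁆ : solGroup a ha (S : Set ℝ)).2
      have e : ⁅p, q⁆ * (q * p) = p * q := by rw [commutatorElement_def]; group
      have e' : ∀ x, (⁅p, q⁆ : solGroup a ha (S : Set ℝ)).1 (q.1 (p.1 x)) = p.1 (q.1 x) := fun x =>
        congrArg (fun g : solGroup a ha (S : Set ℝ) => g.1 x) e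
      have e0 := e' 0
      have e1 := e' 1
      simp only [hp, hq, hc] at e0 e1
      have hn : a ^ n ≠ 0 := zpow_ne_zero _ ha
      have hm : a ^ m ≠ 0 := zpow_ne_zero _ ha
      have h1 : a ^ l = 1 := by
        have : a ^ n * a ^ m * (a ^ l - 1) = 0 := by linear_combination e1 - e0
        rcases mul_eq_zero.1 this with h | h
        · exact absurd h (mul_ne_zero hn hm)
        · linarith
      exact ⟨t, fun x => by rw [hc, h1]; ring⟩
    obtain ⟨t, ht⟩ := key
    apply sol_ext
    intro x
    rw [Subgroup.coe_mul, Subgroup.coe_mul, Equiv.Perm.mul_apply, Equiv.Perm.mul_apply, ht, ht]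
    simp; ring
  · intro H
    obtain ⟨n, j, hj, hg⟩ := (mem_sol ha h g.1).1 g.2
    obtain ⟨s, hs, hs0⟩ := h.nz
    have hc : ⁅mulEl ha S, trEl ha s hs⁆ = trEl ha (a * s - s) (S.sub_mem (h.mul s hs) hs) := by
      rw [commutatorElement_def, mul_inv_eq_iff_eq_mul, mul_inv_eq_iff_eq_mul]
      apply sol_ext
      intro x
      simp only [Subgroup.coe_mul, Equiv.Perm.mul_apply, trEl_apply, mulEl_apply]
      ring
    have e := H (mulEl ha S) (trEl ha s hs)
    rw [hc] at e
    have e0 := congrArg (fun g : solGroup a ha (S : Set ℝ) => g.1 0) e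
    simp only [Subgroup.coe_mul, Equiv.Perm.mul_apply, trEl_apply, hg] at e0
    have ha1 : a ≠ 1 := fun h1 => by simpa using h.pw 1 (by simpa using h1)
    have hn : a ^ n = 1 := by
      have : (a - 1) * s * (a ^ n - 1) = 0 := by linear_combination e0
      rcases mul_eq_zero.1 this with h | h
      · exact absurd h (mul_ne_zero (sub_ne_zero.2 ha1) hs0)
      · linarith
    exact ⟨j, hj, sol_ext fun x => by rw [hg, hn, trEl_apply]; ring⟩

lemma tr_map {a c : ℝ} {ha : a ≠ 0} {hc : c ≠ 0} {S S' : AddSubgroup ℝ} (h : GoodPair a S)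
    (h' : GoodPair c S') (φ : solGroup a ha (S : Set ℝ) ≃* solGroup c hc (S' : Set ℝ))
    (s : ℝ) (hs : s ∈ S) : ∃ t, ∃ ht : t ∈ S', φ (trEl ha s hs) = trEl hc t ht := by
  rw [tr_iff h']
  intro p q
  have := (tr_iff h _).1 ⟨s, hs, rfl⟩ (φ.symm p) (φ.symm q)
  have := congrArg φ this
  simpa [map_mul, map_commutatorElement] using this

lemma conj_eq {a : ℝ} {ha : a ≠ 0} {S : AddSubgroup ℝ} (h : GoodPair a S)
    (g : solGroup a ha (S : Set ℝ)) : ∃ n : ℤ, ∀ s, ∀ hs : s ∈ S,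
      g * trEl ha s hs = trEl ha (a ^ n * s) (h.zpow n s hs) * g := by
  obtain ⟨n, j, hj, hg⟩ := (mem_sol ha h g.1).1 g.2
  refine ⟨n, fun s hs => sol_ext fun x => ?_⟩
  simp only [Subgroup.coe_mul, Equiv.Perm.mul_apply, trEl_apply, hg]
  ring

lemma trEl_inj {a : ℝ} {ha : a ≠ 0} {S : AddSubgroup ℝ} {s t : ℝ} {hs : s ∈ S} {ht : t ∈ S}
    (h : trEl ha s hs = trEl ha t ht) : s = t := by
  simpa using congrArg (fun g : solGroup a ha (S : Set ℝ) => g.1 0) h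

lemma trEl_congr {a : ℝ} {ha : a ≠ 0} {S : AddSubgroup ℝ} {s t : ℝ} {hs : s ∈ S} {ht : t ∈ S}
    (h : s = t) : trEl ha s hs = trEl ha t ht := by
  subst h; rfl

lemma sol_forward {a c : ℝ} {ha : a ≠ 0} {hc : c ≠ 0} {S S' : AddSubgroup ℝ} (h : GoodPair a S)
    (h' : GoodPair c S') (φ : solGroup a ha (S : Set ℝ) ≃* solGroup c hc (S' : Set ℝ)) :
    ∃ F : ℝ → ℝ, Set.BijOn F S S' ∧ (∀ s ∈ S, ∀ t ∈ S, F (s + t) = F s + F t) ∧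
      ∃ γ, (γ = c ∨ γ = c⁻¹) ∧ ∀ s ∈ S, F (a * s) = γ * F s := by
  classical
  let F : ℝ → ℝ := fun s => if hs : s ∈ S then (tr_map h h' φ s hs).choose else 0
  have hF : ∀ s (hs : s ∈ S), ∃ ht : F s ∈ S', φ (trEl ha s hs) = trEl hc (F s) ht := by
    intro s hs
    have : F s = (tr_map h h' φ s hs).choose := dif_pos hs
    rw [this]
    exact (tr_map h h' φ s hs).choose_spec
  have hFm : ∀ s ∈ S, F s ∈ S' := fun s hs => (hF s hs).1
  have hFe : ∀ s (hs : s ∈ S), φ (trEl ha s hs) = trEl hc (F s) (hFm s hs) := fun s hs => (hF s hs).2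
  have hinj : Set.InjOn F S := by
    intro s hs t ht hst
    apply trEl_inj (ha := ha) (hs := hs) (ht := ht)
    apply φ.injective
    rw [hFe, hFe]
    exact trEl_congr hst
  have hadd : ∀ s ∈ S, ∀ t ∈ S, F (s + t) = F s + F t := by
    intro s hs t ht
    have e : trEl ha (s + t) (S.add_mem hs ht) = trEl ha s hs * trEl ha t ht :=
      sol_ext fun x => by
        simp only [Subgroup.coe_mul, Equiv.Perm.mul_apply, trEl_apply]; ring
    have e := congrArg φ e
    rw [map_mul, hFe, hFe, hFe] at e
    simpa using congrArg (fun g : solGroup c hc (S' : Set ℝ) => g.1 0) e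
  refine ⟨F, ⟨hFm, hinj, ?_⟩, hadd, ?_⟩
  · intro k hk
    obtain ⟨s, hs, e⟩ := tr_map h' h φ.symm k hk
    refine ⟨s, hs, ?_⟩
    have e := congrArg φ e
    rw [MulEquiv.apply_symm_apply, hFe] at e
    exact (trEl_inj e).symm
  · obtain ⟨n, hn⟩ := conj_eq h' (φ (mulEl ha S))
    have hmul : ∀ s ∈ S, F (a * s) = c ^ n * F s := by
      intro s hs
      have e : mulEl ha S * trEl ha s hs = trEl ha (a * s) (h.mul s hs) * mulEl ha S :=
        sol_ext fun x => by
          simp only [Subgroup.coe_mul, Equiv.Perm.mul_apply, trEl_apply, mulEl_apply]; ring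
      have e := congrArg φ e
      rw [map_mul, map_mul, hFe, hFe, hn] at e
      exact (trEl_inj (mul_right_cancel e)).symm
    have hcn : c ^ n ≠ 0 := zpow_ne_zero _ hc
    have hpow : ∀ m : ℤ, ∀ s ∈ S, F (a ^ m * s) = (c ^ n) ^ m * F s := by
      intro m
      induction m using Int.induction_on with
      | zero => intro s hs; simp
      | succ i ih =>
        intro s hs
        have := ih _ (h.mul s hs)
        rwa [← mul_assoc, ← zpow_add_one₀ ha, hmul s hs, ← mul_assoc, ← zpow_add_one₀ hcn] at this
      | pred i ih =>
        intro s hs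
        have e := ih _ (h.inv s hs)
        have e2 := hmul _ (h.inv s hs)
        rw [mul_inv_cancel_left₀ ha] at e2
        rw [← mul_assoc, ← zpow_sub_one₀ ha] at e
        rw [e, e2, ← mul_assoc, ← zpow_add_one₀ hcn]
        simp
    obtain ⟨m, hm⟩ := conj_eq h (φ.symm (mulEl hc S'))
    obtain ⟨s, hs, hs0⟩ := h.nz
    have e := congrArg φ (hm s hs)
    rw [map_mul, map_mul, hFe, hFe, MulEquiv.apply_symm_apply] at e
    have e0 := congrArg (fun g : solGroup c hc (S' : Set ℝ) => g.1 0) e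
    simp only [Subgroup.coe_mul, Equiv.Perm.mul_apply, trEl_apply, mulEl_apply, hpow m s hs] at e0
    have hF0 : F 0 = 0 := by
      have := hadd 0 S.zero_mem 0 S.zero_mem
      rw [add_zero] at this
      linarith
    have hFs : F s ≠ 0 := fun h0 => hs0 (hinj hs S.zero_mem (h0.trans hF0.symm))
    have e1 : c = c ^ (n * m) := by
      apply mul_right_cancel₀ hFs
      rw [zpow_mul]
      linarith
    have e2 : n * m - 1 = 0 := by
      apply h'.pw
      rw [zpow_sub_one₀ hc, ← e1, mul_inv_cancel₀ hc]
    refine ⟨c ^ n, ?_, hmul⟩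
    rcases Int.eq_one_or_neg_one_of_mul_eq_one (by linarith : n * m = 1) with h1 | h1 <;> subst h1
    · simp
    · simp

lemma sol_inv (c : ℝ) (hc : c ≠ 0) (T : Set ℝ) :
    solGroup c⁻¹ (inv_ne_zero hc) T = solGroup c hc T := by
  have e : (Equiv.mulLeft₀ c⁻¹ (inv_ne_zero hc) : Equiv.Perm ℝ) = (Equiv.mulLeft₀ c hc : Equiv.Perm ℝ)⁻¹ := by
    ext x
    rw [Equiv.Perm.eq_inv_iff_eq]
    simp [hc]
  unfold solGroup
  rw [Subgroup.closure_union, Subgroup.closure_union, e, Subgroup.closure_singleton_inv]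

/-- Parametrisation of the group by pairs. -/
noncomputable def solParam {a : ℝ} (ha : a ≠ 0) {S : AddSubgroup ℝ} (h : GoodPair a S) :
    ℤ × S ≃ solGroup a ha (S : Set ℝ) :=
  Equiv.ofBijective (fun p => trEl ha p.2.1 p.2.2 * mulEl ha S ^ p.1) (by
    have key : ∀ (p : ℤ × S) (x : ℝ),
      (trEl ha p.2.1 p.2.2 * mulEl ha S ^ p.1 : solGroup a ha (S : Set ℝ)).1 x = a ^ p.1 * x + p.2.1 := by
      intro p x
      rw [Subgroup.coe_mul, Equiv.Perm.mul_apply, Subgroup.coe_zpow, trEl_apply]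
      have := mulLeft_zpow_apply ha p.1 x
      rw [add_comm]
      congr 1
    constructor
    · intro p q hpq
      have e := fun x => congrArg (fun g : solGroup a ha (S : Set ℝ) => g.1 x) hpq
      simp only [key] at e
      have e0 := e 0
      have e1 := e 1
      simp only [mul_zero, zero_add, mul_one] at e0 e1
      have hq : a ^ q.1 ≠ 0 := zpow_ne_zero _ ha
      have : a ^ (p.1 - q.1) = 1 := by
        rw [zpow_sub₀ ha, div_eq_one_iff_eq hq]; linarith
      have := h.pw _ this
      exact Prod.ext (by linarith) (Subtype.ext e0)
    · intro g
      obtain ⟨n, j, hj, hg⟩ := (mem_sol ha h g.1).1 g.2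
      exact ⟨(n, ⟨j, hj⟩), sol_ext fun x => by rw [hg]; exact key (n, ⟨j, hj⟩) x⟩)

lemma solParam_apply {a : ℝ} (ha : a ≠ 0) {S : AddSubgroup ℝ} (h : GoodPair a S) (p : ℤ × S)
    (x : ℝ) : (solParam ha h p).1 x = a ^ p.1 * x + p.2.1 := by
  change (trEl ha p.2.1 p.2.2 * mulEl ha S ^ p.1 : solGroup a ha (S : Set ℝ)).1 x = _
  rw [Subgroup.coe_mul, Equiv.Perm.mul_apply, Subgroup.coe_zpow, trEl_apply]
  have := mulLeft_zpow_apply ha p.1 x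
  rw [add_comm]
  congr 1

lemma sol_backward {a c : ℝ} {ha : a ≠ 0} {hc : c ≠ 0} {S S' : AddSubgroup ℝ} (h : GoodPair a S)
    (h' : GoodPair c S') (F : ℝ → ℝ) (hF : Set.BijOn F S S')
    (hadd : ∀ s ∈ S, ∀ t ∈ S, F (s + t) = F s + F t)
    (hmul : ∀ s ∈ S, F (a * s) = c * F s) :
    Nonempty (solGroup a ha (S : Set ℝ) ≃* solGroup c hc (S' : Set ℝ)) := by
  have hpow : ∀ m : ℤ, ∀ s ∈ S, F (a ^ m * s) = c ^ m * F s := by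
    intro m
    induction m using Int.induction_on with
    | zero => intro s hs; simp
    | succ i ih =>
      intro s hs
      have := ih _ (h.mul s hs)
      rwa [← mul_assoc, ← zpow_add_one₀ ha, hmul s hs, ← mul_assoc, ← zpow_add_one₀ hc] at this
    | pred i ih =>
      intro s hs
      have e := ih _ (h.inv s hs)
      have e2 := hmul _ (h.inv s hs)
      rw [mul_inv_cancel_left₀ ha] at e2
      rw [← mul_assoc, ← zpow_sub_one₀ ha] at e
      rw [e, e2, ← mul_assoc, ← zpow_add_one₀ hc]
      simp
  let E : ℤ × S ≃ ℤ × S' := Equiv.prodCongr (Equiv.refl ℤ) (Set.BijOn.equiv F hF)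
  have hE : ∀ p, E p = (p.1, ⟨F p.2.1, hF.mapsTo p.2.2⟩) := fun p => rfl
  refine ⟨MulEquiv.mk' ((solParam ha h).symm.trans (E.trans (solParam hc h'))) ?_⟩
  intro x y
  obtain ⟨p, rfl⟩ := (solParam ha h).surjective x
  obtain ⟨q, rfl⟩ := (solParam ha h).surjective y
  have e : solParam ha h p * solParam ha h q = solParam ha h
      (p.1 + q.1, ⟨a ^ p.1 * q.2.1 + p.2.1, S.add_mem (h.zpow _ _ q.2.2) p.2.2⟩) := by
    apply sol_ext
    intro x
    rw [Subgroup.coe_mul, Equiv.Perm.mul_apply]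
    simp only [solParam_apply, zpow_add₀ ha]
    ring
  rw [e]
  simp only [Equiv.trans_apply, Equiv.symm_apply_apply, hE]
  apply sol_ext
  intro x
  rw [Subgroup.coe_mul, Equiv.Perm.mul_apply]
  simp only [solParam_apply, zpow_add₀ hc]
  rw [hadd _ (h.zpow _ _ q.2.2) _ p.2.2, hpow _ _ q.2.2]
  ring

lemma GoodPair.invPair {c : ℝ} {S : AddSubgroup ℝ} (h : GoodPair c S) : GoodPair c⁻¹ S where
  ne0 := inv_ne_zero h.ne0
  pw n hn := h.pw n (by rwa [inv_zpow, inv_eq_one] at hn)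
  mul := h.inv
  inv := by simpa using h.mul
  nz := h.nz

lemma sol_iff {a c : ℝ} {ha : a ≠ 0} {hc : c ≠ 0} {S S' : AddSubgroup ℝ} (h : GoodPair a S)
    (h' : GoodPair c S') :
    Nonempty (solGroup a ha (S : Set ℝ) ≃* solGroup c hc (S' : Set ℝ)) ↔
    ∃ F : ℝ → ℝ, Set.BijOn F S S' ∧ (∀ s ∈ S, ∀ t ∈ S, F (s + t) = F s + F t) ∧
      ∃ γ, (γ = c ∨ γ = c⁻¹) ∧ ∀ s ∈ S, F (a * s) = γ * F s := by
  constructor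
  · rintro ⟨φ⟩
    exact sol_forward h h' φ
  · rintro ⟨F, hF, hadd, γ, rfl | rfl, hmul⟩
    · exact sol_backward h h' F hF hadd hmul
    · rw [← sol_inv c hc]
      exact sol_backward h h'.invPair F hF hadd hmul

lemma bij_aux {S S' : Set ℝ} {G : ℝ → ℝ} {l m : ℝ} (hl : l ≠ 0) (hm : m ≠ 0) (hG : Set.InjOn G S)
    (h : (fun x => l * x) '' (G '' S) = (fun x => m * x) '' S') :
    Set.BijOn (fun x => l / m * G x) S S' := by
  refine ⟨?_, ?_, ?_⟩
  · intro x hx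
    have : l * G x ∈ (fun x => m * x) '' S' := h ▸ ⟨G x, ⟨x, hx, rfl⟩, rfl⟩
    obtain ⟨k, hk, e⟩ := this
    have : l / m * G x = k := by
      simp only at e
      field_simp
      linarith
    simpa only [this] using hk
  · intro x hx y hy e
    exact hG hx hy (mul_left_cancel₀ (div_ne_zero hl hm) e)
  · intro k hk
    have : m * k ∈ (fun x => l * x) '' (G '' S) := h ▸ ⟨k, hk, rfl⟩
    obtain ⟨_, ⟨x, hx, rfl⟩, e⟩ := this
    refine ⟨x, hx, ?_⟩
    simp only at e ⊢
    field_simp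
    linarith

section Quad

variable {α : ℝ} {τ ε : ℤ}

lemma mem_quad (hq : α ^ 2 = (τ : ℝ) * α - (ε : ℝ)) (x : ℝ) :
    x ∈ Subring.closure {α} ↔ ∃ m n : ℤ, x = m + n * α := by
  constructor
  · intro hx
    induction hx using Subring.closure_induction with
    | mem x hx => exact ⟨0, 1, by simpa using hx⟩
    | zero => exact ⟨0, 0, by simp⟩
    | one => exact ⟨1, 0, by simp⟩
    | add x y _ _ hx hy =>
      obtain ⟨m, n, rfl⟩ := hx
      obtain ⟨m', n', rfl⟩ := hy
      exact ⟨m + m', n + n', by push_cast; ring⟩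
    | neg x _ hx =>
      obtain ⟨m, n, rfl⟩ := hx
      exact ⟨-m, -n, by push_cast; ring⟩
    | mul x y _ _ hx hy =>
      obtain ⟨m, n, rfl⟩ := hx
      obtain ⟨m', n', rfl⟩ := hy
      exact ⟨m * m' - n * n' * ε, m * n' + n * m' + n * n' * τ, by
        push_cast; linear_combination (n * n' : ℝ) * hq⟩
  · rintro ⟨m, n, rfl⟩
    exact add_mem (intCast_mem _ m) (mul_mem (intCast_mem _ n) (Subring.subset_closure rfl))

lemma quad_zero (hi : Irrational α) {m n : ℤ} (h : (m : ℝ) + n * α = 0) : m = 0 ∧ n = 0 := by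
  have hn : n = 0 := by
    by_contra hn
    apply hi
    refine ⟨-m / n, ?_⟩
    have : (n : ℝ) ≠ 0 := by exact_mod_cast hn
    push_cast
    field_simp
    linarith
  subst hn
  simpa using h

lemma quad_inj (hi : Irrational α) {m n m' n' : ℤ} (h : (m : ℝ) + n * α = m' + n' * α) :
    m = m' ∧ n = n' := by
  have := quad_zero hi (m := m - m') (n := n - n') (by push_cast; linarith)
  omega

lemma quad_inv (h0 : α ≠ 0) (hε : ε = 1 ∨ ε = -1) (hq : α ^ 2 = (τ : ℝ) * α - (ε : ℝ)) :
    α⁻¹ = ε * (τ - α) := by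
  have : (ε : ℝ) ^ 2 = 1 := by rcases hε with rfl | rfl <;> norm_num
  apply inv_eq_of_mul_eq_one_right
  linear_combination (-ε : ℝ) * hq + this

lemma irr_pw (hi : Irrational α) (n : ℤ) (h : α ^ n = 1) : n = 0 := by
  have h1 : |α| ≠ 1 := by
    intro h1
    rcases (abs_eq zero_le_one).1 h1 with h | h
    · exact hi.ne_one h
    · exact hi ⟨-1, by rw [h]; norm_num⟩
  apply zpow_right_injective₀ (abs_pos.2 hi.ne_zero) h1
  simp only [zpow_zero]
  rw [← abs_zpow, h, abs_one]

/-- The underlying additive subgroup of `ℝ` of an ideal. -/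
def idealAdd (J : Ideal (Subring.closure {α} : Subring ℝ)) : AddSubgroup ℝ :=
  J.toAddSubgroup.map (Subring.closure {α}).subtype.toAddMonoidHom

lemma coe_idealAdd (J : Ideal (Subring.closure {α} : Subring ℝ)) :
    (Subtype.val '' (J : Set (Subring.closure {α} : Subring ℝ))) = (idealAdd J : Set ℝ) := rfl

lemma mem_idealAdd (J : Ideal (Subring.closure {α} : Subring ℝ)) (x : ℝ) :
    x ∈ idealAdd J ↔ ∃ h : x ∈ Subring.closure {α}, (⟨x, h⟩ : Subring.closure {α}) ∈ J := by
  rw [← SetLike.mem_coe, ← coe_idealAdd]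
  simp

lemma idealAdd_mul (J : Ideal (Subring.closure {α} : Subring ℝ)) {r x : ℝ}
    (hr : r ∈ Subring.closure {α}) (hx : x ∈ idealAdd J) : r * x ∈ idealAdd J := by
  rw [mem_idealAdd] at hx ⊢
  obtain ⟨h, hx⟩ := hx
  exact ⟨mul_mem hr h, J.mul_mem_left ⟨r, hr⟩ hx⟩

lemma good_ideal (hi : Irrational α) (hε : ε = 1 ∨ ε = -1) (hq : α ^ 2 = (τ : ℝ) * α - (ε : ℝ))
    (J : Ideal (Subring.closure {α} : Subring ℝ)) (hJ : J ≠ ⊥) : GoodPair α (idealAdd J) where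
  ne0 := hi.ne_zero
  pw := irr_pw hi
  mul s hs := idealAdd_mul J (Subring.subset_closure rfl) hs
  inv s hs := idealAdd_mul J (by
    rw [quad_inv hi.ne_zero hε hq]
    exact mul_mem (intCast_mem _ _) (sub_mem (intCast_mem _ _) (Subring.subset_closure rfl))) hs
  nz := by
    obtain ⟨x, hx, h0⟩ := Submodule.exists_mem_ne_zero_of_ne_bot hJ
    exact ⟨x.1, (mem_idealAdd J _).2 ⟨x.2, hx⟩, fun h => h0 (Subtype.ext h)⟩

lemma conj_exists (hi : Irrational α) (hq : α ^ 2 = (τ : ℝ) * α - (ε : ℝ)) :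
    ∃ conj : (Subring.closure {α} : Subring ℝ) →+* (Subring.closure {α} : Subring ℝ),
      (conj ⟨α, Subring.subset_closure rfl⟩ : ℝ) = (τ : ℝ) - α := by
  have hm : ∀ x : (Subring.closure {α} : Subring ℝ), ∃ m n : ℤ, x.1 = m + n * α :=
    fun x => (mem_quad hq x.1).1 x.2
  choose m n hmn using hm
  have hτ : (τ : ℝ) - α ∈ Subring.closure {α} :=
    sub_mem (intCast_mem _ _) (Subring.subset_closure rfl)
  let f : (Subring.closure {α} : Subring ℝ) → (Subring.closure {α} : Subring ℝ) := fun x =>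
    ⟨m x + n x * (τ - α), add_mem (intCast_mem _ _) (mul_mem (intCast_mem _ _) hτ)⟩
  have hf : ∀ (x : (Subring.closure {α} : Subring ℝ)) (p q : ℤ), x.1 = p + q * α →
      (f x).1 = p + q * (τ - α) := by
    intro x p q hx
    obtain ⟨h1, h2⟩ := quad_inj hi ((hmn x).symm.trans hx)
    change (m x : ℝ) + n x * (τ - α) = _
    rw [h1, h2]
  refine ⟨{ toFun := f, map_one' := ?_, map_mul' := ?_, map_zero' := ?_, map_add' := ?_ }, ?_⟩
  · apply Subtype.ext
    rw [hf 1 1 0 (by simp)]; simp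
  · intro x y
    apply Subtype.ext
    rw [hf (x * y) (m x * m y - n x * n y * ε) (m x * n y + n x * m y + n x * n y * τ)]
    · rw [Subring.coe_mul, hf x _ _ (hmn x), hf y _ _ (hmn y)]
      push_cast
      linear_combination (- n x * n y : ℝ) * hq
    · rw [Subring.coe_mul, hmn x, hmn y]
      push_cast
      linear_combination (n x * n y : ℝ) * hq
  · apply Subtype.ext
    rw [hf 0 0 0 (by simp)]; simp
  · intro x y
    apply Subtype.ext
    rw [hf (x + y) (m x + m y) (n x + n y)]
    · rw [Subring.coe_add, hf x _ _ (hmn x), hf y _ _ (hmn y)]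
      push_cast
      ring
    · rw [Subring.coe_add, hmn x, hmn y]
      push_cast
      ring
  · change (f _ : ℝ) = _
    rw [hf _ 0 1 (by simp)]; simp

lemma conj_apply
    (conj : (Subring.closure {α} : Subring ℝ) →+* (Subring.closure {α} : Subring ℝ))
    (hc : (conj ⟨α, Subring.subset_closure rfl⟩ : ℝ) = (τ : ℝ) - α)
    (x : (Subring.closure {α} : Subring ℝ)) (m n : ℤ) (hx : x.1 = m + n * α) :
    (conj x : ℝ) = m + n * (τ - α) := by
  have : x = m + n * ⟨α, Subring.subset_closure rfl⟩ := Subtype.ext (by simpa using hx)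
  rw [this, map_add, map_mul, map_intCast, map_intCast]
  simp [hc]

lemma conj_inj (hi : Irrational α) (hq : α ^ 2 = (τ : ℝ) * α - (ε : ℝ))
    (conj : (Subring.closure {α} : Subring ℝ) →+* (Subring.closure {α} : Subring ℝ))
    (hc : (conj ⟨α, Subring.subset_closure rfl⟩ : ℝ) = (τ : ℝ) - α) :
    Function.Injective conj := by
  rw [injective_iff_map_eq_zero]
  intro x hx
  obtain ⟨m, n, hmn⟩ := (mem_quad hq x.1).1 x.2
  have h := conj_apply conj hc x m n hmn
  rw [hx] at h
  obtain ⟨h1, h2⟩ := quad_zero hi (m := m + n * τ) (n := -n)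
    (by push_cast; rw [ZeroMemClass.coe_zero] at h; linarith)
  have h2 : n = 0 := by omega
  subst h2
  have h1 : m = 0 := by simpa using h1
  subst h1
  exact Subtype.ext (by simpa using hmn)

end Quad

lemma additive_int {S : AddSubgroup ℝ} {F : ℝ → ℝ}
    (hadd : ∀ s ∈ S, ∀ t ∈ S, F (s + t) = F s + F t) (m : ℤ) (s : ℝ) (hs : s ∈ S) :
    F (m * s) = m * F s := by
  let f : S →+ ℝ := AddMonoidHom.mk' (fun x => F x.1) (fun x y => hadd _ x.2 _ y.2)
  have := map_zsmul f m ⟨s, hs⟩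
  simpa [f] using this

/-- for irrational real quadratic units `α, β` (with `α² = τα − ε`,
`β² = τ'β − ε'`, `ε, ε' = ±1`) and nonzero ideals `J ⊆ ℤ[α]`, `K ⊆ ℤ[β]`, the
groups `G(α,J)` and `G(β,K)` are isomorphic iff either `β ∈ {α, α⁻¹}` and
`λJ = μK` for some nonzero `λ, μ ∈ ℤ[α]`, or `β ∈ {ᾱ, ᾱ⁻¹}` (`ᾱ = τ − α`) and
`λJ̄ = μK` for some nonzero `λ, μ ∈ ℤ[α]`, where `J̄` is the image of `J` under
the conjugation automorphism of `ℤ[α]` sending `α` to `τ − α`. -/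
theorem stmt0 (α β : ℝ) (hαirr : Irrational α) (hβirr : Irrational β)
    (τ ε τ' ε' : ℤ) (hε : ε = 1 ∨ ε = -1) (hε' : ε' = 1 ∨ ε' = -1)
    (hαq : α ^ 2 = (τ : ℝ) * α - (ε : ℝ)) (hβq : β ^ 2 = (τ' : ℝ) * β - (ε' : ℝ))
    (J : Ideal (Subring.closure {α} : Subring ℝ))
    (K : Ideal (Subring.closure {β} : Subring ℝ))
    (hJ : J ≠ ⊥) (hK : K ≠ ⊥) :
    Nonempty
        (solGroup α hαirr.ne_zero
            (Subtype.val '' (J : Set (Subring.closure {α} : Subring ℝ))) ≃*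
          solGroup β hβirr.ne_zero
            (Subtype.val '' (K : Set (Subring.closure {β} : Subring ℝ)))) ↔
      (((β = α ∨ β = α⁻¹) ∧
          ∃ lam mu : (Subring.closure {α} : Subring ℝ), lam ≠ 0 ∧ mu ≠ 0 ∧
            (fun x : ℝ => (lam : ℝ) * x) ''
                (Subtype.val '' (J : Set (Subring.closure {α} : Subring ℝ))) =
              (fun x : ℝ => (mu : ℝ) * x) ''
                (Subtype.val '' (K : Set (Subring.closure {β} : Subring ℝ)))) ∨
        ((β = (τ : ℝ) - α ∨ β = ((τ : ℝ) - α)⁻¹) ∧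
          ∃ lam mu : (Subring.closure {α} : Subring ℝ), lam ≠ 0 ∧ mu ≠ 0 ∧
            ∃ conj : (Subring.closure {α} : Subring ℝ) →+* (Subring.closure {α} : Subring ℝ),
              (conj ⟨α, Subring.subset_closure rfl⟩ : ℝ) = (τ : ℝ) - α ∧
              (fun x : ℝ => (lam : ℝ) * x) ''
                  (Subtype.val '' (conj '' (J : Set (Subring.closure {α} : Subring ℝ)))) =
                (fun x : ℝ => (mu : ℝ) * x) ''
                  (Subtype.val '' (K : Set (Subring.closure {β} : Subring ℝ))))) := by
  have gα := good_ideal hαirr hε hαq J hJ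
  have gβ := good_ideal hβirr hε' hβq K hK
  rw [coe_idealAdd J, coe_idealAdd K, sol_iff gα gβ]
  have hαR : α ∈ Subring.closure {α} := Subring.subset_closure rfl
  constructor
  · rintro ⟨F, hF, hadd, γ, hγ, hmul⟩
    have hFint := additive_int hadd
    have hlin : ∀ (m n : ℤ), ∀ s ∈ idealAdd J, F ((m + n * α) * s) = (m + n * γ) * F s := by
      intro m n s hs
      have e : ((m : ℝ) + n * α) * s = m * s + n * (α * s) := by ring
      rw [e, hadd _ (idealAdd_mul J (intCast_mem _ m) hs) _
        (idealAdd_mul J (intCast_mem _ n) (gα.mul s hs)), hFint _ _ hs, hFint _ _ (gα.mul s hs),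
        hmul s hs]
      ring
    obtain ⟨j0, hj0, hj00⟩ := gα.nz
    have hF0 : F 0 = 0 := by simpa using hFint 0 0 (idealAdd J).zero_mem
    have hFj : F j0 ≠ 0 := fun h0 =>
      hj00 (hF.injOn hj0 (idealAdd J).zero_mem (h0.trans hF0.symm))
    have hγq : γ ^ 2 = τ * γ - ε := by
      have e1 := hmul _ (gα.mul _ hj0)
      rw [hmul _ hj0] at e1
      have e2 := hlin (-ε) τ j0 hj0
      have e3 : ((-ε : ℤ) + (τ : ℝ) * α) * j0 = α * (α * j0) := by
        push_cast
        linear_combination (- j0) * hαq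
      rw [e3, e1] at e2
      apply mul_right_cancel₀ hFj
      push_cast at e2
      linarith
    have hγα : γ = α ∨ γ = τ - α := by
      have : (γ - α) * (γ - (τ - α)) = 0 := by linear_combination hγq - hαq
      rcases mul_eq_zero.1 this with h | h
      · left; linarith
      · right; linarith
    have hγR : γ ∈ Subring.closure {α} := by
      rcases hγα with rfl | rfl
      · exact hαR
      · exact sub_mem (intCast_mem _ _) hαR
    have hγ0 : γ ≠ 0 := by
      rcases hγ with rfl | rfl
      · exact hβirr.ne_zero
      · exact inv_ne_zero hβirr.ne_zero
    have hβγ : β = γ ∨ β = γ⁻¹ := by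
      rcases hγ with rfl | rfl
      · exact Or.inl rfl
      · right; simp
    have hβR : β ∈ Subring.closure {α} := by
      rcases hβγ with h | h
      · rwa [h]
      · rw [h, quad_inv hγ0 hε hγq]
        exact mul_mem (intCast_mem _ _) (sub_mem (intCast_mem _ _) hγR)
    have hle : Subring.closure {β} ≤ Subring.closure {α} :=
      Subring.closure_le.2 (by simpa using hβR)
    have hk0 : F j0 ∈ Subring.closure {α} :=
      hle ((mem_idealAdd K _).1 (hF.mapsTo hj0)).1
    have hj0R : j0 ∈ Subring.closure {α} := ((mem_idealAdd J _).1 hj0).1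
    rcases hγα with rfl | h
    · left
      have hlinR : ∀ r ∈ Subring.closure {γ}, ∀ s ∈ idealAdd J, F (r * s) = r * F s := by
        intro r hr s hs
        obtain ⟨m, n, rfl⟩ := (mem_quad hαq r).1 hr
        exact hlin m n s hs
      have hcomm : ∀ j ∈ idealAdd J, F j0 * j = j0 * F j := by
        intro j hj
        have hjR := ((mem_idealAdd J _).1 hj).1
        rw [← hlinR j0 hj0R j hj, mul_comm j0 j, hlinR j hjR j0 hj0, mul_comm]
      refine ⟨hβγ, ⟨F j0, hk0⟩, ⟨j0, hj0R⟩, fun h => hFj (congrArg Subtype.val h),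
        fun h => hj00 (congrArg Subtype.val h), ?_⟩
      ext x
      constructor
      · rintro ⟨j, hj, rfl⟩
        exact ⟨F j, hF.mapsTo hj, (hcomm j hj).symm⟩
      · rintro ⟨k, hk, rfl⟩
        obtain ⟨j, hj, rfl⟩ := hF.surjOn hk
        exact ⟨j, hj, hcomm j hj⟩
    · right
      obtain ⟨conj, hconj⟩ := conj_exists hαirr hαq
      have hlinR : ∀ r : (Subring.closure {α} : Subring ℝ), ∀ s ∈ idealAdd J,
          F (r * s) = conj r * F s := by
        intro r s hs
        obtain ⟨m, n, hmn⟩ := (mem_quad hαq r.1).1 r.2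
        rw [conj_apply conj hconj r m n hmn, hmn, ← h]
        exact hlin m n s hs
      have hcomm : ∀ j : (Subring.closure {α} : Subring ℝ), j ∈ J →
          F j0 * conj j = conj ⟨j0, hj0R⟩ * F j := by
        intro j hj
        have hj' : j.1 ∈ idealAdd J := (mem_idealAdd J _).2 ⟨j.2, hj⟩
        have := hlinR ⟨j0, hj0R⟩ j hj'
        rw [← this, mul_comm (F j0), ← hlinR j j0 hj0, mul_comm]
      have hci := conj_inj hαirr hαq conj hconj
      refine ⟨by rwa [← h], ⟨F j0, hk0⟩, conj ⟨j0, hj0R⟩, fun h => hFj (congrArg Subtype.val h),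
        fun h => hj00 (congrArg Subtype.val (hci (h.trans (map_zero conj).symm))), conj, hconj, ?_⟩
      ext x
      constructor
      · rintro ⟨_, ⟨_, ⟨j, hj, rfl⟩, rfl⟩, rfl⟩
        exact ⟨F j, hF.mapsTo ((mem_idealAdd J _).2 ⟨j.2, hj⟩), (hcomm j hj).symm⟩
      · rintro ⟨k, hk, rfl⟩
        obtain ⟨j, hj, rfl⟩ := hF.surjOn hk
        obtain ⟨hjR, hj⟩ := (mem_idealAdd J _).1 hj
        exact ⟨_, ⟨_, ⟨⟨j, hjR⟩, hj, rfl⟩, rfl⟩, hcomm ⟨j, hjR⟩ hj⟩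
  · rintro (⟨hβα, lam, mu, hl, hm, e⟩ | ⟨hβα, lam, mu, hl, hm, conj, hconj, e⟩)
    · have hl' : (lam : ℝ) ≠ 0 := fun h => hl (Subtype.ext h)
      have hm' : (mu : ℝ) ≠ 0 := fun h => hm (Subtype.ext h)
      refine ⟨fun x => lam / mu * id x, bij_aux hl' hm' Function.injective_id.injOn
        (by rw [Set.image_id]; exact e), fun s _ t _ => by simp only [id]; ring, α, ?_,
        fun s _ => by simp only [id]; ring⟩
      rcases hβα with rfl | rfl
      · exact Or.inl rfl
      · right; simp
    · have hl' : (lam : ℝ) ≠ 0 := fun h => hl (Subtype.ext h)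
      have hm' : (mu : ℝ) ≠ 0 := fun h => hm (Subtype.ext h)
      classical
      let G : ℝ → ℝ := fun x => if h : x ∈ Subring.closure {α} then (conj ⟨x, h⟩ : ℝ) else 0
      have hG : ∀ x (h : x ∈ Subring.closure {α}), G x = conj ⟨x, h⟩ := fun x h => dif_pos h
      have hR : ∀ x ∈ idealAdd J, x ∈ Subring.closure {α} :=
        fun x hx => ((mem_idealAdd J _).1 hx).1
      have hci := conj_inj hαirr hαq conj hconj
      refine ⟨fun x => lam / mu * G x, bij_aux hl' hm' ?_ ?_, ?_, τ - α, ?_, ?_⟩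
      · intro x hx y hy hxy
        rw [hG x (hR x hx), hG y (hR y hy)] at hxy
        exact congrArg Subtype.val (hci (Subtype.ext hxy))
      · have : G '' (idealAdd J : Set ℝ) = Subtype.val '' (conj '' (J : Set _)) := by
          ext x
          constructor
          · rintro ⟨y, hy, rfl⟩
            obtain ⟨h, hy⟩ := (mem_idealAdd J _).1 hy
            exact ⟨_, ⟨⟨y, h⟩, hy, rfl⟩, (hG y h).symm⟩
          · rintro ⟨_, ⟨j, hj, rfl⟩, rfl⟩
            exact ⟨j.1, (mem_idealAdd J _).2 ⟨j.2, hj⟩, hG j.1 j.2⟩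
        rw [this]
        exact e
      · intro s hs t ht
        simp only
        rw [hG s (hR s hs), hG t (hR t ht), hG (s + t) (add_mem (hR s hs) (hR t ht)), ← mul_add,
          ← Subring.coe_add, ← map_add]
        rfl
      · rcases hβα with h | h
        · exact Or.inl h.symm
        · right; rw [h, inv_inv]
      · intro s hs
        simp only
        have : (conj ⟨α * s, mul_mem hαR (hR s hs)⟩ : ℝ) = (τ - α) * conj ⟨s, hR s hs⟩ := by
          rw [← hconj, ← Subring.coe_mul, ← map_mul]
          rfl
        rw [hG s (hR s hs), hG (α * s) (mul_mem hαR (hR s hs)), this]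
        ring
end

section
/- Let α be an irrational real quadratic unit, i.e. α ∈ ℝ is irrational and α² = τα − ε for some τ ∈ ℤ and ε = ±1. Then there are, up to isomorphism, only finitely many groups of the form G(α,J) = J ⋊_α ℤ as J ranges over all nonzero ideals of ℤ[α]: there exist finitely many nonzero ideals J₁, …, J_n of ℤ[α] such that for every nonzero ideal J of ℤ[α], the group G(α,J) is isomorphic to G(α,J_i) for some i. -/
/-- Scaling the translation part does not change the group up to isomorphism. -/
theorem solGroup_scale (a : ℝ) (ha : a ≠ 0) (c : ℝ) (hc : c ≠ 0) (J K : Set ℝ)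
    (hK : K = (fun j => c * j) '' J) :
    Nonempty (solGroup a ha J ≃* solGroup a ha K) := by
  have key : (solGroup a ha J).map (MulAut.conj (Equiv.mulLeft₀ c hc)).toMonoidHom
      = solGroup a ha K := by
    unfold solGroup
    rw [MonoidHom.map_closure, Set.image_union, Set.image_singleton, Set.image_image, hK,
      Set.image_image]
    congr 2
    · congr 1
      ext x
      simp [MulAut.conj_apply]
      field_simp
    · apply Set.image_congr
      intro j _
      ext x
      simp [MulAut.conj_apply]
      field_simp
  rw [← key]
  exact ⟨Subgroup.equivMapOfInjective _ _ (MulAut.conj (Equiv.mulLeft₀ c hc)).injective⟩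

theorem mem_closure_quad (α : ℝ) (τ ε : ℤ) (hq : α ^ 2 = (τ : ℝ) * α - (ε : ℝ)) (x : ℝ) :
    x ∈ (Subring.closure {α} : Subring ℝ) ↔ ∃ a b : ℤ, x = a + b * α := by
  constructor
  · intro h
    induction h using Subring.closure_induction with
    | mem x hx => exact ⟨0, 1, by simpa using hx⟩
    | zero => exact ⟨0, 0, by simp⟩
    | one => exact ⟨1, 0, by simp⟩
    | add x y _ _ hx hy =>
      obtain ⟨a, b, rfl⟩ := hx
      obtain ⟨c, d, rfl⟩ := hy
      exact ⟨a + c, b + d, by push_cast; ring⟩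
    | neg x _ hx =>
      obtain ⟨a, b, rfl⟩ := hx
      exact ⟨-a, -b, by push_cast; ring⟩
    | mul x y _ _ hx hy =>
      obtain ⟨a, b, rfl⟩ := hx
      obtain ⟨c, d, rfl⟩ := hy
      exact ⟨a * c - b * d * ε, a * d + b * c + b * d * τ, by
        push_cast; linear_combination (b * d : ℝ) * hq⟩
  · rintro ⟨a, b, rfl⟩
    exact add_mem (intCast_mem _ _)
      (mul_mem (intCast_mem _ _) (Subring.subset_closure rfl))

/-- The norm form. -/
def nf (τ ε a b : ℤ) : ℤ := a ^ 2 + τ * a * b + ε * b ^ 2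

theorem lin_zero (α : ℝ) (hirr : Irrational α) (a b : ℤ) (h : (a : ℝ) + b * α = 0) :
    a = 0 ∧ b = 0 := by
  have hb : b = 0 := by
    by_contra hb
    have h1 := (hirr.intCast_mul hb).intCast_add a
    exact h1.ne_zero h
  subst hb
  simpa using h

theorem nf_zero (α : ℝ) (hirr : Irrational α) (τ ε : ℤ)
    (hq : α ^ 2 = (τ : ℝ) * α - (ε : ℝ)) (a b : ℤ) (h : nf τ ε a b = 0) : a = 0 ∧ b = 0 := by
  have h' : ((a : ℝ) + b * α) * (((a + b * τ : ℤ) : ℝ) + (-b : ℤ) * α) = 0 := by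
    have : ((nf τ ε a b : ℤ) : ℝ) = 0 := by exact_mod_cast h
    unfold nf at this
    push_cast at this ⊢
    linear_combination this - (b : ℝ) ^ 2 * hq
  rcases mul_eq_zero.mp h' with h1 | h1
  · exact lin_zero α hirr _ _ h1
  · obtain ⟨h2, h3⟩ := lin_zero α hirr _ _ h1
    have : b = 0 := by simpa using h3
    subst this
    simpa using h2

/-- Dirichlet approximation for pairs, with a uniform bound. -/
theorem dirichlet_pair (T : ℤ) (hT : 0 < T) : ∃ M : ℕ, ∀ D p q : ℤ, D ≠ 0 →
    ∃ n : ℤ, n ≠ 0 ∧ n.natAbs ≤ M ∧ ∃ r s t u : ℤ, n * p = D * r + s ∧ n * q = D * t + u ∧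
      T * |s| < |D| ∧ T * |u| < |D| := by
  have hδ : (0 : ℝ) < 1 / T := by positivity
  refine ⟨AbsoluteValue.absIsAdmissible.card (1 / T : ℝ) ^ Fintype.card (Fin 2), ?_⟩
  intro D p q hD
  obtain ⟨i, j, hij, h⟩ := AbsoluteValue.absIsAdmissible.exists_approx hδ hD
    (fun i (k : Fin 2) => if k = 0 then (i : ℤ) * p else (i : ℤ) * q)
  have hT' : (0 : ℝ) < T := by exact_mod_cast hT
  have conv : ∀ z : ℤ, ((AbsoluteValue.abs z : ℤ) : ℝ) < (AbsoluteValue.abs D : ℤ) • (1 / T : ℝ) →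
      T * |z| < |D| := by
    intro z hz
    simp only [AbsoluteValue.abs_apply, zsmul_eq_mul, mul_one_div] at hz
    rw [lt_div_iff₀ hT'] at hz
    have : |z| * T < |D| := by exact_mod_cast hz
    linarith
  refine ⟨(j : ℤ) - i, ?_, ?_, ((j : ℤ) * p / D - (i : ℤ) * p / D),
    ((j : ℤ) * p % D - (i : ℤ) * p % D),
    ((j : ℤ) * q / D - (i : ℤ) * q / D), ((j : ℤ) * q % D - (i : ℤ) * q % D), ?_, ?_, conv _ (by simpa using h 0),
    conv _ (by simpa using h 1)⟩
  · intro h0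
    apply hij
    ext
    omega
  · have := i.2
    have := j.2
    omega
  · have h1 := Int.emod_add_mul_ediv ((j : ℤ) * p) D
    have h2 := Int.emod_add_mul_ediv ((i : ℤ) * p) D
    linear_combination h2 - h1
  · have h1 := Int.emod_add_mul_ediv ((j : ℤ) * q) D
    have h2 := Int.emod_add_mul_ediv ((i : ℤ) * q) D
    linear_combination h2 - h1

theorem nf_small (τ ε : ℤ) (hε : ε = 1 ∨ ε = -1) (D s u : ℤ) (hs : (2 + |τ|) * |s| < |D|)
    (hu : (2 + |τ|) * |u| < |D|) : |nf τ ε s u| < |D| ^ 2 := by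
  have e1 : |ε| = 1 := by rcases hε with rfl | rfl <;> rfl
  have hle : |nf τ ε s u| ≤ |s| ^ 2 + |τ| * |s| * |u| + |u| ^ 2 := by
    unfold nf
    calc _ ≤ |s ^ 2| + |τ * s * u| + |ε * u ^ 2| := abs_add_three _ _ _
      _ = _ := by simp [abs_mul, e1]
  have hτ := abs_nonneg τ
  have h1 := abs_nonneg s
  have h2 := abs_nonneg u
  generalize |s| = s at *
  generalize |u| = u at *
  generalize |τ| = t at *
  generalize |D| = d at *
  have hd : 0 < d := by nlinarith
  have hsd : s < d := by nlinarith
  have hud : u < d := by nlinarith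
  have a1 : s ^ 2 ≤ s * d := by nlinarith
  have a2 : t * s * u ≤ t * s * d := by
    apply mul_le_mul_of_nonneg_left hud.le; positivity
  have a3 : 2 * u ≤ d := by nlinarith
  have a4 : u ^ 2 * 2 ≤ d * d := by nlinarith
  have a5 : 2 * s ≤ d := by nlinarith
  rcases le_total s u with h | h
  · have : t * s * u ≤ t * u * d := by
      have : t * s * u ≤ t * d * u := by
        apply mul_le_mul_of_nonneg_right _ h2
        apply mul_le_mul_of_nonneg_left hsd.le hτ
      linarith
    have : s ^ 2 ≤ u * d := by nlinarith
    have : u ^ 2 ≤ u * d := by nlinarith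
    nlinarith
  · have : u ^ 2 ≤ s * d := by nlinarith
    nlinarith

/-- Every nonzero ideal has an element `x` with `N J ⊆ x R`, with uniform `N`. -/
theorem exists_uniform (α : ℝ) (hirr : Irrational α) (τ ε : ℤ) (hε : ε = 1 ∨ ε = -1)
    (hq : α ^ 2 = (τ : ℝ) * α - (ε : ℝ)) :
    ∃ N : ℕ, N ≠ 0 ∧ ∀ J : Ideal (Subring.closure {α} : Subring ℝ), J ≠ ⊥ →
      ∃ x ∈ J, x ≠ 0 ∧ ∀ y ∈ J, ∃ z, (N : (Subring.closure {α} : Subring ℝ)) * y = x * z := by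
  obtain ⟨M, hM⟩ := dirichlet_pair (2 + |τ|) (by positivity)
  refine ⟨M.factorial, M.factorial_ne_zero, ?_⟩
  intro J hJ
  obtain ⟨w, hw, hw0⟩ := Submodule.exists_mem_ne_zero_of_ne_bot hJ
  let P : ℕ → Prop := fun k => ∃ x ∈ J, x ≠ 0 ∧ ∃ a b : ℤ, (x : ℝ) = a + b * α ∧
    (nf τ ε a b).natAbs = k
  have hP : ∃ k, P k := by
    obtain ⟨a, b, hab⟩ := (mem_closure_quad α τ ε hq w).mp w.2
    exact ⟨_, w, hw, hw0, a, b, hab, rfl⟩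
  classical
  obtain ⟨x, hx, hx0, a, b, hab, hk⟩ := Nat.find_spec hP
  have hmin : ∀ k, P k → Nat.find hP ≤ k := fun k hk => Nat.find_min' hP hk
  rw [← hk] at hmin
  refine ⟨x, hx, hx0, ?_⟩
  intro y hy
  obtain ⟨c, d, hcd⟩ := (mem_closure_quad α τ ε hq y).mp y.2
  set D := nf τ ε a b with hD
  have hD0 : D ≠ 0 := by
    intro h0
    obtain ⟨rfl, rfl⟩ := nf_zero α hirr τ ε hq a b h0
    apply hx0
    ext
    simpa using hab
  obtain ⟨n, hn0, hnM, r, s, t, u, h1, h2, h3, h4⟩ :=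
    hM D (c * (a + b * τ) + d * b * ε) (d * a - c * b) hD0
  have hsm := nf_small τ ε hε D s u h3 h4
  set e := n * c - (r * a - t * b * ε) with he
  set f := n * d - (r * b + t * a + t * b * τ) with hf
  have hprod : nf τ ε e f * D = nf τ ε s u := by
    have hs : s = e * (a + b * τ) + f * b * ε := by
      rw [he, hf]; rw [hD] at h1; unfold nf at h1; linear_combination -h1
    have hu : u = f * a - e * b := by
      rw [he, hf]; rw [hD] at h2; unfold nf at h2; linear_combination -h2
    rw [hs, hu, hD]; unfold nf; ring
  have hlt : |nf τ ε e f| < |D| := by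
    rw [← hprod, abs_mul, sq] at hsm
    exact lt_of_mul_lt_mul_right hsm (abs_nonneg _)
  let R := (Subring.closure {α} : Subring ℝ)
  let z : R := ⟨r + t * α, (mem_closure_quad α τ ε hq _).mpr ⟨r, t, rfl⟩⟩
  have hv : (((n : R) * y - x * z : R) : ℝ) = e + f * α := by
    push_cast [z, he, hf, hab, hcd]
    linear_combination (-(b * t) : ℝ) * hq
  have hzero : (n : R) * y - x * z = 0 := by
    by_contra hne
    have := hmin _ ⟨(n : R) * y - x * z,
      J.sub_mem (J.mul_mem_left _ hy) (J.mul_mem_right _ hx), hne, e, f, hv, rfl⟩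
    rw [Int.abs_eq_natAbs, Int.abs_eq_natAbs] at hlt
    omega
  have hdvd : n ∣ (M.factorial : ℤ) := by
    rw [← Int.natAbs_dvd]
    exact_mod_cast Nat.dvd_factorial (Int.natAbs_pos.mpr hn0) hnM
  obtain ⟨m, hm⟩ := hdvd
  refine ⟨m * z, ?_⟩
  have hm' : ((M.factorial : ℕ) : R) = (n : R) * (m : R) := by exact_mod_cast congrArg (Int.cast : ℤ → R) hm
  change ((M.factorial : ℕ) : R) * y = x * ((m : R) * z)
  rw [hm']
  linear_combination (m : R) * hzero

theorem finite_ideals (α : ℝ) (τ ε : ℤ) (hq : α ^ 2 = (τ : ℝ) * α - (ε : ℝ)) (N : ℕ)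
    (hN : N ≠ 0) :
    {I : Ideal (Subring.closure {α} : Subring ℝ) |
      (N : (Subring.closure {α} : Subring ℝ)) ∈ I}.Finite := by
  let R := (Subring.closure {α} : Subring ℝ)
  let A : R := ⟨α, Subring.subset_closure rfl⟩
  let F : Ideal R → Set (Fin N × Fin N) := fun I => {p | ((p.1 : ℕ) : R) + ((p.2 : ℕ) : R) * A ∈ I}
  have hred : ∀ x : R, ∃ p : Fin N × Fin N, ∀ I : Ideal R, (N : R) ∈ I →
      (x ∈ I ↔ p ∈ F I) := by
    intro x
    obtain ⟨a, b, hab⟩ := (mem_closure_quad α τ ε hq x).mp x.2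
    have hx : x = (a : R) + (b : R) * A := by
      ext; push_cast [A]; exact hab
    have hNz : (N : ℤ) ≠ 0 := by exact_mod_cast hN
    have hNp : (0 : ℤ) < N := by omega
    have key : ∀ a : ℤ, ∃ i : Fin N, ∃ k : ℤ, a = (i : ℕ) + N * k := by
      intro a
      have h0 := Int.emod_nonneg a hNz
      have h1 := Int.emod_lt_of_pos a hNp
      refine ⟨⟨(a % N).toNat, by omega⟩, a / N, ?_⟩
      have := Int.emod_add_mul_ediv a N
      simp only [Int.toNat_of_nonneg h0]
      exact this.symm
    obtain ⟨i, k, hi⟩ := key a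
    obtain ⟨j, l, hj⟩ := key b
    refine ⟨(i, j), fun I hI => ?_⟩
    have hxe : x = (((i : ℕ) : R) + ((j : ℕ) : R) * A) + ((k : R) + (l : R) * A) * (N : R) := by
      rw [hx, hi, hj]; push_cast; ring
    change x ∈ I ↔ ((i : ℕ) : R) + ((j : ℕ) : R) * A ∈ I
    rw [hxe]
    exact I.add_mem_iff_left (I.mul_mem_left _ hI)
  refine Set.Finite.of_finite_image (f := F) (Set.toFinite _) ?_
  intro I hI K hK hIK
  ext x
  obtain ⟨p, hp⟩ := hred x
  rw [hp I hI, hp K hK, hIK]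

/-- for an irrational real quadratic unit `α` (with `α² = τα − ε`,
`ε = ±1`), there are, up to isomorphism, only finitely many groups
`G(α,J) = J ⋊_α ℤ` as `J` ranges over all nonzero ideals of `ℤ[α]`. -/
theorem stmt1 (α : ℝ) (hirr : Irrational α) (τ ε : ℤ) (hε : ε = 1 ∨ ε = -1)
    (hq : α ^ 2 = (τ : ℝ) * α - (ε : ℝ)) :
    ∃ S : Finset (Ideal (Subring.closure {α} : Subring ℝ)),
      (∀ J ∈ S, J ≠ ⊥) ∧
      ∀ J : Ideal (Subring.closure {α} : Subring ℝ), J ≠ ⊥ →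
        ∃ J' ∈ S, Nonempty
          (solGroup α hirr.ne_zero
              (Subtype.val '' (J : Set (Subring.closure {α} : Subring ℝ))) ≃*
            solGroup α hirr.ne_zero
              (Subtype.val '' (J' : Set (Subring.closure {α} : Subring ℝ)))) := by
  obtain ⟨N, hN, hJ⟩ := exists_uniform α hirr τ ε hε hq
  have hfin := finite_ideals α τ ε hq N hN
  refine ⟨hfin.toFinset, ?_, ?_⟩
  · intro J hJ h
    rw [Set.Finite.mem_toFinset, Set.mem_ofPred_eq, h, Ideal.mem_bot] at hJ
    exact hN (by exact_mod_cast hJ)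
  · intro J hJ0
    obtain ⟨x, hx, hx0, hdiv⟩ := hJ J hJ0
    let I : Ideal (Subring.closure {α} : Subring ℝ) :=
      { carrier := {z | ∃ y ∈ J, (N : (Subring.closure {α} : Subring ℝ)) * y = x * z}
        add_mem' := by
          rintro z w ⟨y, hy, h1⟩ ⟨y', hy', h2⟩
          exact ⟨y + y', J.add_mem hy hy', by rw [mul_add, mul_add, h1, h2]⟩
        zero_mem' := ⟨0, J.zero_mem, by simp⟩
        smul_mem' := by
          rintro c z ⟨y, hy, h1⟩
          exact ⟨c * y, J.mul_mem_left _ hy, by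
            rw [smul_eq_mul]; linear_combination c * h1⟩ }
    have hxr : (x : ℝ) ≠ 0 := by exact_mod_cast hx0
    have hNr : (N : ℝ) ≠ 0 := by exact_mod_cast hN
    refine ⟨I, ?_, ?_⟩
    · rw [Set.Finite.mem_toFinset]
      exact ⟨x, hx, mul_comm _ _⟩
    · refine solGroup_scale α _ ((N : ℝ) / x) (div_ne_zero hNr hxr) _ _ ?_
      ext v
      constructor
      · rintro ⟨z, ⟨y, hy, h⟩, rfl⟩
        refine ⟨y, ⟨y, hy, rfl⟩, ?_⟩
        have h' : (N : ℝ) * y = x * z := by exact_mod_cast congrArg Subtype.val h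
        simp only
        field_simp
        linarith
      · rintro ⟨_, ⟨y, hy, rfl⟩, rfl⟩
        obtain ⟨z, h⟩ := hdiv y hy
        refine ⟨z, ⟨y, hy, h⟩, ?_⟩
        have h' : (N : ℝ) * y = x * z := by exact_mod_cast congrArg Subtype.val h
        simp only
        field_simp
        linarith
end
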